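/- Suppose u is a J_α-ultrafilter on ℕ for some α < ω₁, and for each n ∈ ℕ the ultrafilter v_n is a J_{α_n}-ultrafilter for some α_n < ω₁. Then there exists β < ω₁ such that the sum ∑_u v_n is a J_β-ultrafilter on ℕ × ℕ. -/

import Mathlib

open Set Topology Filter MeasureTheory

/-- The Cantor space `2^ω = ℕ → Bool` with the product topology. -/
abbrev Cantor := ℕ → Bool

/-- `u` is an `I`-ultrafilter: for every `F : ℕ → X` there is `A ∈ u` with `F '' A ∈ I`. -/
def IUltra {X : Type*} (I : Set (Set X)) (u : Ultrafilter ℕ) : Prop :=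
  ∀ F : ℕ → X, ∃ A ∈ u, F '' A ∈ I

/-- The same notion for ultrafilters on `ℕ × ℕ`. -/
def IUltra2 {X : Type*} (I : Set (Set X)) (u : Ultrafilter (ℕ × ℕ)) : Prop :=
  ∀ F : ℕ × ℕ → X, ∃ A ∈ u, F '' A ∈ I

/-- `u` is a P-point: nonprincipal, and every countable family of members of `u`
has a pseudo-intersection in `u`. -/
def IsPPoint (u : Ultrafilter ℕ) : Prop :=
  (∀ a : ℕ, u ≠ pure a) ∧
    ∀ A : ℕ → Set ℕ, (∀ n, A n ∈ u) → ∃ B ∈ u, ∀ n, (B \ A n).Finite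

/-- A subset of Cantor space is discrete: every point of `A` is isolated in `A`. -/
def DiscreteSet (A : Set Cantor) : Prop :=
  ∀ x ∈ A, ∃ U : Set Cantor, IsOpen U ∧ A ∩ U = {x}

/-- A subset of Cantor space is scattered: every nonempty subset has an isolated point. -/
def ScatteredSet (A : Set Cantor) : Prop :=
  ∀ B ⊆ A, B.Nonempty → ∃ x ∈ B, ∃ U : Set Cantor, IsOpen U ∧ B ∩ U = {x}

/-- The basic clopen cylinder `[s]` determined by a finite binary sequence `s`. -/
def cyl (s : List Bool) : Set Cantor := {f | ∀ i : Fin s.length, f i = s.get i}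

/-- `I` is an ideal: closed under subsets and finite unions. -/
def IsIdeal (I : Set (Set Cantor)) : Prop :=
  (∀ A B : Set Cantor, A ⊆ B → B ∈ I → A ∈ I) ∧
    (∀ A B : Set Cantor, A ∈ I → B ∈ I → A ∪ B ∈ I)

/-- `I` is closed under discrete unions. -/
def ClosedUnderDiscreteUnions (I : Set (Set Cantor)) : Prop :=
  ∀ (X G : ℕ → Set Cantor), (∀ n, X n ∈ I) → (∀ n, IsOpen (G n)) →
    Pairwise (Function.onFun Disjoint G) → (⋃ n, X n ∩ G n) ∈ I

/-- A discrete ideal: an ideal closed under discrete unions. -/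
def DiscreteIdeal (I : Set (Set Cantor)) : Prop := IsIdeal I ∧ ClosedUnderDiscreteUnions I

/-- `I` is closed under scattered unions. -/
def ClosedUnderScatteredUnions (I : Set (Set Cantor)) : Prop :=
  ∀ (S : Set (List Bool)) (X : List Bool → Set Cantor),
    S.WellFoundedOn (fun s t => cyl s ⊂ cyl t) → (∀ s ∈ S, X s ∈ I) →
    (⋃ s ∈ S, X s ∩ cyl s) ∈ I

/-- The sum `∑_u v_n`: the ultrafilter on `ℕ × ℕ` with
`X ∈ ∑_u v_n ↔ {n | {m | (n, m) ∈ X} ∈ v n} ∈ u`. -/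
def ultraSum (u : Ultrafilter ℕ) (v : ℕ → Ultrafilter ℕ) : Ultrafilter (ℕ × ℕ) :=
  u.bind fun n => (v n).map fun m => (n, m)

/-- Iterated derivative: `dA = {x ∈ A : x is an accumulation point of A}`;
`A` has level `≤ k` iff `d^k A = ∅`. -/
def HasLevelLE (k : ℕ) (A : Set Cantor) : Prop :=
  (fun B : Set Cantor => {x ∈ B | AccPt x (𝓟 B)})^[k] A = ∅

/-- Finite Fubini powers of `u` (relative to a pairing bijection `e`). -/
noncomputable def ultraPow (e : ℕ × ℕ ≃ ℕ) (u : Ultrafilter ℕ) : ℕ → Ultrafilter ℕ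
  | 0 => pure 0
  | n + 1 => Ultrafilter.map e (ultraSum u fun _ => ultraPow e u n)

/-- `u^ω = ∑_u ⟨u^n : n < ω⟩`, an ultrafilter on `ℕ × ℕ`. -/
noncomputable def ultraPowOmega (e : ℕ × ℕ ≃ ℕ) (u : Ultrafilter ℕ) : Ultrafilter (ℕ × ℕ) :=
  ultraSum u (ultraPow e u)

/-- The order type of a set of ordinals. -/
noncomputable def tp (X : Set Ordinal) : Ordinal := Ordinal.type ((· < ·) : X → X → Prop)

/-- The first uncountable ordinal. -/
noncomputable def omega1 : Ordinal := (Cardinal.aleph 1).ord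

/-- `u` is an `α`-ultrafilter (`I_α`-ultrafilter, where `I_α` is the family of subsets of
`ω₁` of order type `≤ α`). -/
def AlphaUltra (α : Ordinal) (u : Ultrafilter ℕ) : Prop :=
  ∀ F : ℕ → Ordinal, (∀ n, F n < omega1) → ∃ A ∈ u, tp (F '' A) ≤ α

/-- `u` is a `J_α`-ultrafilter (`J_α` is the family of subsets of `ω₁` of order type `< α`). -/
def JUltra (α : Ordinal) (u : Ultrafilter ℕ) : Prop :=
  ∀ F : ℕ → Ordinal, (∀ n, F n < omega1) → ∃ A ∈ u, tp (F '' A) < α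

/-- The `J_α`-ultrafilter notion for ultrafilters on `ℕ × ℕ`. -/
def JUltra2 (α : Ordinal) (u : Ultrafilter (ℕ × ℕ)) : Prop :=
  ∀ F : ℕ × ℕ → Ordinal, (∀ p, F p < omega1) → ∃ A ∈ u, tp (F '' A) < α

open Ordinal Cardinal in
lemma omega1_eq_omega_one : omega1 = ω₁ := by
  rw [omega1, Cardinal.ord_aleph]

lemma iSup_lt_omega1 {ι : Type*} [Countable ι] {f : ι → Ordinal} (hf : ∀ i, f i < omega1) :
    ⨆ i, f i < omega1 := by
  rw [omega1_eq_omega_one] at *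
  exact Ordinal.iSup_lt_omega_one hf

lemma succ_lt_omega1 {o : Ordinal} (ho : o < omega1) : Order.succ o < omega1 :=
  (Cardinal.isSuccLimit_ord (Cardinal.aleph0_le_aleph 1)).succ_lt ho

lemma countable_Iio_of_lt_omega1 {o : Ordinal} (ho : o < omega1) : Countable (Iio o) := by
  rw [omega1, Cardinal.lt_ord, Cardinal.lt_aleph_one_iff] at ho
  rw [← Cardinal.mk_le_aleph0_iff, Cardinal.mk_Iio_ordinal]
  exact Cardinal.lift_le_aleph0.2 ho

universe v w in
lemma exists_strictMono_lt_omega1 (W : Type w) [Preorder W] [WellFoundedLT W] [Countable W] :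
    ∃ g : W → Ordinal.{v}, StrictMono g ∧ ∃ β < omega1, ∀ x, g x < β := by
  have : Small.{v} W := Countable.toSmall W
  let r : Shrink.{v, w} W → Shrink.{v, w} W → Prop :=
    fun a b => (equivShrink W).symm a < (equivShrink W).symm b
  have : IsWellFounded _ r := ⟨InvImage.wf _ wellFounded_lt⟩
  have : Countable (Shrink.{v, w} W) := (equivShrink W).symm.injective.countable
  have hlt (a : Shrink.{v, w} W) : IsWellFounded.rank r a < omega1 := by
    induction a using IsWellFounded.induction r with
    | ind a ih =>
      rw [IsWellFounded.rank_eq]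
      exact iSup_lt_omega1 fun b => succ_lt_omega1 (ih b b.2)
  refine ⟨fun x => IsWellFounded.rank r (equivShrink W x), fun x y hxy => ?_,
    Order.succ (⨆ a, IsWellFounded.rank r a), succ_lt_omega1 (iSup_lt_omega1 hlt), fun x =>
      Order.lt_succ_of_le (Ordinal.le_iSup _ _)⟩
  exact IsWellFounded.rank_lt_of_rel (by simpa [r] using hxy)

universe v w in
lemma exists_lift_eq_of_lt_omega1 {a : Ordinal.{v}} (ha : a < omega1) :
    ∃ b : Ordinal.{0}, Ordinal.lift.{v} b = a ∧ Ordinal.lift.{w} b < omega1 := by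
  have h : a ≤ Ordinal.lift.{v, 0} omega1 := by
    rw [omega1_eq_omega_one] at *
    simpa using ha.le
  obtain ⟨b, rfl⟩ := Ordinal.mem_range_lift_of_le.{0, v} h
  rw [omega1_eq_omega_one] at *
  exact ⟨b, rfl, by simpa using ha⟩

universe v w in
lemma exists_strictMonoOn_omega1 :
    ∃ c : Ordinal.{v} → Ordinal.{w}, StrictMonoOn c (Iio omega1) ∧ ∀ a < omega1, c a < omega1 := by
  choose! b hb hb' using fun (a : Ordinal.{v}) => exists_lift_eq_of_lt_omega1.{v, w} (a := a)
  refine ⟨fun a => Ordinal.lift.{w} (b a), fun x hx y hy hxy => ?_, hb'⟩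
  rw [← hb x hx, ← hb y hy] at hxy
  simpa using hxy

universe v w in
/-- The property of being a `J_α`-ultrafilter for some `α < ω₁` is independent of the universe. -/
lemma JUltra.exists_universe_lift {α : Ordinal.{v + 1}} (hα : α < omega1) {u : Ultrafilter ℕ}
    (hu : JUltra.{v} α u) : ∃ β : Ordinal.{w + 1}, β < omega1 ∧ JUltra.{w} β u := by
  obtain ⟨c, hc, hc'⟩ := exists_strictMonoOn_omega1.{w, v}
  obtain ⟨a, rfl, ha⟩ := exists_lift_eq_of_lt_omega1.{v + 1, w + 1} hα
  refine ⟨_, ha, fun F hF => ?_⟩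
  obtain ⟨A, hA, hlt⟩ := hu (c ∘ F) fun n => hc' _ (hF n)
  refine ⟨A, hA, ?_⟩
  have hmono : StrictMonoOn c (F '' A) := hc.mono (by rintro _ ⟨n, -, rfl⟩; exact hF n)
  have heq : Ordinal.lift.{v + 1} (tp (F '' A)) =
      Ordinal.lift.{w + 1} (tp (c '' (F '' A))) :=
    Ordinal.lift_type_eq.{_, _, 0}.2 ⟨(hmono.orderIso c _).toRelIsoLT⟩
  rw [image_comp, ← Ordinal.lift_lt.{w + 1}, ← heq] at hlt
  rw [← Ordinal.lift_lt.{v + 1}]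
  simpa using hlt

universe v in
lemma tp_le_of_strictMono {X : Set Ordinal.{v}} {β : Ordinal.{v + 1}}
    (f : X → Ordinal.{v + 1}) (hf : StrictMono f) (hβ : ∀ x, f x < β) : tp X ≤ β := by
  have h : Ordinal.lift.{v + 2} (tp X) ≤ Ordinal.lift.{v + 1} (Ordinal.type
      ((· < ·) : Iio β → Iio β → Prop)) := by
    refine Ordinal.lift_type_le.{_, _, 0}.2 ⟨RelEmbedding.collapse ?_⟩
    exact RelEmbedding.ofMonotone (fun x => ⟨f x, hβ x⟩) fun x y h => hf h
  rw [Ordinal.type_lt_Iio] at h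
  simpa using h

lemma tp_mono {X Y : Set Ordinal} (h : X ⊆ Y) : tp X ≤ tp Y := Ordinal.type_mono h

lemma tp_empty : tp ∅ = 0 := Ordinal.type_eq_zero_of_empty _

lemma tp_inter_Iio_lt {X : Set Ordinal} {z : Ordinal} (hz : z ∈ X) : tp (X ∩ Iio z) < tp X := by
  refine Ordinal.type_lt_iff.2 ⟨⟨⟨⟨Set.inclusion inter_subset_left, Set.inclusion_injective _⟩,
    Iff.rfl⟩, ⟨z, hz⟩, fun b => ?_⟩⟩
  constructor
  · rintro ⟨x, rfl⟩
    exact x.2.2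
  · exact fun h => ⟨⟨b, b.2, h⟩, rfl⟩

lemma tp_inter_Iio_mono (X : Set Ordinal) : Monotone fun z => tp (X ∩ Iio z) :=
  fun _ _ h => tp_mono (inter_subset_inter_right _ (Iio_subset_Iio h))

lemma tp_inter_Iio_strict {X : Set Ordinal} {z z' : Ordinal} (hz : z ∈ X) (h : z < z') :
    tp (X ∩ Iio z) < tp (X ∩ Iio z') := by
  have := tp_inter_Iio_lt (X := X ∩ Iio z') ⟨hz, h⟩
  rwa [inter_assoc, Iio_inter_Iio, min_eq_right h.le] at this

lemma mem_ultraSum {u : Ultrafilter ℕ} {v : ℕ → Ultrafilter ℕ} {X : Set (ℕ × ℕ)} :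
    X ∈ ultraSum u v ↔ {n | {m | (n, m) ∈ X} ∈ v n} ∈ u := Iff.rfl

/-- Along an ultrafilter, a map into the countable ordinals concentrates below and at a limit. -/
lemma Ultrafilter.exists_ordinal_limit (v : Ultrafilter ℕ) {F : ℕ → Ordinal}
    (hF : ∀ m, F m < omega1) :
    ∃ μ < omega1, {m | F m ≤ μ} ∈ v ∧ ∀ ξ < μ, {m | ξ < F m} ∈ v := by
  let S : Set Ordinal := {μ | {m | F m ≤ μ} ∈ v}
  have hS : (⨆ m, F m) ∈ S := Filter.univ_mem' fun m => Ordinal.le_iSup F m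
  refine ⟨sInf S, (csInf_le' hS).trans_lt (iSup_lt_omega1 hF), csInf_mem ⟨_, hS⟩, fun ξ hξ => ?_⟩
  have := Ultrafilter.compl_mem_iff_notMem.2 (show {m | F m ≤ ξ} ∉ v from
    notMem_of_lt_csInf' (s := S) hξ)
  simpa [compl_ofPred] using this

universe w in
/-- The combinatorial core: if the sets `X n ⊆ [0, μ n]` have order type below `γ`, all but finitely
many of those with `ξ < μ n` lie above `ξ`, and the `μ n` form a set of type below `α`, then
`⋃ n, X n` embeds in a countable well-founded order depending only on `α` and `γ`. -/
lemma exists_strictMono_iUnion {ι : Type*} {α γ : Ordinal.{w + 1}} [Zero (Iio γ)]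
    (h0 : ((0 : Iio γ) : Ordinal) = 0) (X : ι → Set Ordinal.{w}) (μ : ι → Ordinal.{w})
    (hX : ∀ n, tp (X n) < γ) (hμ : tp (range μ) < α) (hle : ∀ n, ∀ x ∈ X n, x ≤ μ n)
    (hfin : ∀ n, ∀ ξ ≤ μ n, {k | ξ < μ k ∧ (X k ∩ Iio ξ).Nonempty}.Finite) :
    ∃ f : (⋃ n, X n : Set Ordinal.{w}) → Iio α ×ₗ WithTop (ι →₀ Iio γ), StrictMono f := by
  classical
  have hbound (z : (⋃ n, X n : Set Ordinal.{w})) : ∃ n, z.1 ≤ μ n := by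
    obtain ⟨n, hn⟩ := mem_iUnion.1 z.2
    exact ⟨n, hle n z hn⟩
  let i (z : (⋃ n, X n : Set Ordinal.{w})) : Iio α := ⟨tp (range μ ∩ Iio z.1), by
    obtain ⟨n, hn⟩ := hbound z
    exact (tp_inter_Iio_mono _ hn).trans_lt ((tp_inter_Iio_lt (mem_range_self n)).trans hμ)⟩
  let r₀ (z : (⋃ n, X n : Set Ordinal.{w})) (n : ι) : Iio γ :=
    if z.1 < μ n then ⟨tp (X n ∩ Iio z.1), (tp_mono inter_subset_left).trans_lt (hX n)⟩ else 0
  have hr₀ (z) : (Function.support (r₀ z)).Finite := by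
    obtain ⟨n, hn⟩ := hbound z
    refine (hfin n z hn).subset fun k hk => ?_
    by_cases hz : z.1 < μ k
    · refine ⟨hz, nonempty_iff_ne_empty.2 fun h => hk ?_⟩
      simp only [r₀, if_pos hz]
      exact Subtype.ext (by simp [h, h0, tp_empty])
    · exact absurd (if_neg hz) hk
  let r (z) : ι →₀ Iio γ := Finsupp.ofSupportFinite (r₀ z) (hr₀ z)
  refine ⟨fun z => toLex (i z, if z.1 ∈ range μ then ⊤ else (r z : WithTop _)), fun z z' hzz' => ?_⟩
  have hzz : z.1 < z'.1 := hzz'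
  rw [Prod.Lex.toLex_lt_toLex]
  have hi : i z ≤ i z' := tp_inter_Iio_mono _ hzz.le
  refine hi.lt_or_eq.imp id fun heq => ⟨heq, ?_⟩
  have hgap (n : ι) (hz : z.1 ≤ μ n) : z'.1 ≤ μ n := by
    by_contra! hlt
    refine (congrArg Subtype.val heq).not_lt ?_
    exact (tp_inter_Iio_mono _ hz).trans_lt (tp_inter_Iio_strict (mem_range_self n) hlt)
  have hz : z.1 ∉ range μ := by
    rintro ⟨n, hn⟩
    exact (hgap n hn.ge).not_gt (hn ▸ hzz)
  rw [if_neg hz]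
  split_ifs with hz'
  · exact WithTop.coe_lt_top _
  have hiff (n : ι) : z.1 < μ n ↔ z'.1 < μ n :=
    ⟨fun h => (hgap n h.le).lt_of_ne fun h' => hz' ⟨n, h'.symm⟩, hzz.trans⟩
  have hmono : r z ≤ r z' := fun n => by
    change r₀ z n ≤ r₀ z' n
    simp only [r₀, ← hiff]
    split_ifs
    · exact tp_inter_Iio_mono _ hzz.le
    · exact le_rfl
  obtain ⟨n, hn⟩ := mem_iUnion.1 z.2
  have hzn : z.1 < μ n := (hle n z hn).lt_of_ne fun h => hz ⟨n, h.symm⟩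
  refine WithTop.coe_lt_coe.2 (lt_of_le_not_ge hmono fun h => (h n).not_gt ?_)
  change r₀ z n < r₀ z' n
  simp only [r₀, ← hiff, if_pos hzn]
  exact tp_inter_Iio_strict hn hzz

universe w in
lemma exists_jUltra2_ultraSum {u : Ultrafilter ℕ} {α : Ordinal.{w + 1}} (hα : α < omega1)
    (hu : JUltra α u) {v : ℕ → Ultrafilter ℕ} {αs : ℕ → Ordinal.{w + 1}}
    (hαs : ∀ n, αs n < omega1) (hv : ∀ n, JUltra (αs n) (v n)) :
    ∃ β : Ordinal.{w + 1}, β < omega1 ∧ JUltra2 β (ultraSum u v) := by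
  set γ : Ordinal.{w + 1} := Order.succ (⨆ n, αs n)
  have hγ1 : γ < omega1 := succ_lt_omega1 (iSup_lt_omega1 hαs)
  have hαγ (n : ℕ) : αs n < γ := Order.lt_succ_of_le (Ordinal.le_iSup αs n)
  let : Zero (Iio γ) := ⟨⟨0, zero_le.trans_lt (hαγ 0)⟩⟩
  have := countable_Iio_of_lt_omega1 hα
  have := countable_Iio_of_lt_omega1 hγ1
  have : WellFoundedLT (ℕ →₀ Iio γ) :=
    Finsupp.wellFoundedLT fun n h => not_lt_bot (α := Ordinal) h
  have : Countable (Iio α ×ₗ WithTop (ℕ →₀ Iio γ)) :=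
    inferInstanceAs (Countable (Iio α × Option (ℕ →₀ Iio γ)))
  obtain ⟨g, hg, β, hβ, hgβ⟩ :=
    exists_strictMono_lt_omega1.{w + 1} (Iio α ×ₗ WithTop (ℕ →₀ Iio γ))
  refine ⟨Order.succ β, succ_lt_omega1 hβ, fun F hF => ?_⟩
  choose μ hμ hμle hμlt using fun n => (v n).exists_ordinal_limit fun m => hF (n, m)
  choose B hB hBtp using fun n => hv n (fun m => F (n, m)) fun m => hF (n, m)
  obtain ⟨A, hA, hAtp⟩ := hu μ hμ
  obtain ⟨d, hd⟩ : ∃ d : ℕ → Ordinal.{w}, Iic (⨆ n, μ n) = range d := by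
    have := countable_Iio_of_lt_omega1 (succ_lt_omega1 (iSup_lt_omega1 hμ))
    rw [← Order.Iio_succ]
    exact (Set.to_countable _).exists_eq_range ⟨_, mem_Iio.2 (Order.lt_succ _)⟩
  let C (n : ℕ) : Set ℕ :=
    (B n ∩ {m | F (n, m) ≤ μ n}) ∩ ⋂ k ∈ Iic n, {m | d k < μ n → d k < F (n, m)}
  have hC (n : ℕ) : C n ∈ v n := by
    refine inter_mem (inter_mem (hB n) (hμle n)) ((biInter_mem (finite_Iic n)).2 fun k _ => ?_)
    by_cases h : d k < μ n
    · exact mem_of_superset (hμlt n _ h) fun m hm _ => hm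
    · exact Filter.univ_mem' fun m h' => absurd h' h
  refine ⟨{p | p.1 ∈ A ∧ p.2 ∈ C p.1}, mem_ultraSum.2 (mem_of_superset hA fun n hn =>
    mem_of_superset (hC n) fun m hm => ⟨hn, hm⟩), Order.lt_succ_of_le ?_⟩
  obtain ⟨n₀, hn₀⟩ := u.nonempty_of_mem hA
  classical
  let X (n : ℕ) : Set Ordinal.{w} := if n ∈ A then (fun m => F (n, m)) '' C n else ∅
  let μ' (n : ℕ) : Ordinal.{w} := if n ∈ A then μ n else μ n₀
  have hXA {n : ℕ} {x : Ordinal} (h : x ∈ X n) : n ∈ A := by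
    by_contra hn
    simp [X, hn] at h
  have hX (n : ℕ) : tp (X n) < γ := by
    refine ((tp_mono fun x hx => ?_).trans_lt (hBtp n)).trans (hαγ n)
    simp only [X, if_pos (hXA hx)] at hx
    exact image_mono (fun m hm => hm.1.1) hx
  have hμ'range : range μ' ⊆ μ '' A := by
    rintro _ ⟨n, rfl⟩
    by_cases hn : n ∈ A
    · exact ⟨n, hn, (if_pos hn).symm⟩
    · exact ⟨n₀, hn₀, (if_neg hn).symm⟩
  have hle (n : ℕ) (x) (hx : x ∈ X n) : x ≤ μ' n := by
    have hn := hXA hx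
    simp only [X, μ', if_pos hn] at hx ⊢
    obtain ⟨m, hm, rfl⟩ := hx
    exact hm.1.2
  have hfin (n : ℕ) (ξ) (hξ : ξ ≤ μ' n) :
      {k | ξ < μ' k ∧ (X k ∩ Iio ξ).Nonempty}.Finite := by
    obtain ⟨l, -, hl⟩ := hμ'range (mem_range_self n)
    obtain ⟨j, rfl⟩ : ξ ∈ range d := hd ▸ hξ.trans (hl ▸ Ordinal.le_iSup μ l)
    refine (finite_Iio j).subset fun k ⟨hk, x, hx, hxj⟩ => ?_
    have hkA := hXA hx
    simp only [X, μ', if_pos hkA] at hx hk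
    obtain ⟨m, hm, rfl⟩ := hx
    by_contra hjk
    exact (mem_iInter₂.1 hm.2 j (mem_Iic.2 (not_lt.1 hjk)) hk).not_gt hxj
  obtain ⟨f, hf⟩ :=
    exists_strictMono_iUnion rfl X μ' hX ((tp_mono hμ'range).trans_lt hAtp) hle hfin
  refine (tp_mono ?_).trans (tp_le_of_strictMono (g ∘ f) (hg.comp hf) fun x => hgβ _)
  rintro _ ⟨⟨n, m⟩, ⟨hn, hm⟩, rfl⟩
  exact mem_iUnion.2 ⟨n, by simpa only [X, if_pos hn] using ⟨m, hm, rfl⟩⟩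

/-- the class `C` of ultrafilters that are `J_α`-ultrafilters for some
`α < ω₁` is closed under `C`-sums. -/
theorem stmt18 (u : Ultrafilter ℕ) (α : Ordinal) (hα : α < omega1) (hu : JUltra α u)
    (v : ℕ → Ultrafilter ℕ) (αs : ℕ → Ordinal)
    (hαs : ∀ n, αs n < omega1) (hv : ∀ n, JUltra (αs n) (v n)) :
    ∃ β < omega1, JUltra2 β (ultraSum u v) := by
  obtain ⟨α', hα', hu'⟩ := hu.exists_universe_lift hα
  choose αs' hαs' hv' using fun n => (hv n).exists_universe_lift (hαs n)
  exact exists_jUltra2_ultraSum hα' hu' hαs' hv'
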